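/- Let r be a positive integer with r ≡ 2 (mod 4), let ℓ = C(2r+1, r), and let α be a rational number with α > r²·ℓ·C(ℓ, ℓ/2). Then for every pair of distinct subsets Z, Z' ⊆ U with |Z| = |Z'| = ℓ/2, there exists an important set S ⊆ Q (x ∈ S, |S| = r+1) such that every minimum S-separating bipartition (A, V∖A) of G(r, α) places w_Z and w_{Z'} on opposite sides, i.e., exactly one of w_Z, w_{Z'} lies in A. -/

import Mathlib

namespace DoubleExp

/-- `ℓ = C(2r+1, r)`. -/
abbrev ell (r : ℕ) : ℕ := (2 * r + 1).choose r

/-- Index set of the middle layer `U`: subsets `S ⊆ Q0` of size `r`. -/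
abbrev UIdx (r : ℕ) := {S : Finset (Fin (2 * r + 1)) // S.card = r}

/-- Index set of the last layer `W`: subsets `Z ⊆ U` of size `ℓ/2`. -/
abbrev WIdx (r : ℕ) := {Z : Finset (UIdx r) // Z.card = ell r / 2}

/-- The vertex set of `G(r, α)`: `Q0 ⊎ {x} ⊎ U ⊎ W`. -/
abbrev Vtx (r : ℕ) := (Fin (2 * r + 1) ⊕ Unit) ⊕ (UIdx r ⊕ WIdx r)

/-- The terminal `q ∈ Q0`. -/
def vq (r : ℕ) (i : Fin (2 * r + 1)) : Vtx r := Sum.inl (Sum.inl i)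

/-- The extra terminal `x`. -/
def vx (r : ℕ) : Vtx r := Sum.inl (Sum.inr ())

/-- The middle-layer vertex `u_S`. -/
def vu (r : ℕ) (S : UIdx r) : Vtx r := Sum.inr (Sum.inl S)

/-- The last-layer vertex `w_Z`. -/
def vw (r : ℕ) (Z : WIdx r) : Vtx r := Sum.inr (Sum.inr Z)

/-- The symmetric edge cost function of `G(r, α)`: `u_S q` costs
`(1 + 1/r + 1/r²)·α` if `q ∈ S` and `α` otherwise; `u_S w_Z` costs `1` if `u_S ∈ Z`
and `0` otherwise; `x w_Z` costs `ℓ/2 − 1`; all other pairs are non-adjacent (cost `0`). -/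
def cost (r : ℕ) (α : ℚ) : Vtx r → Vtx r → ℚ
  | Sum.inr (Sum.inl S), Sum.inl (Sum.inl q) =>
      if q ∈ S.1 then (1 + 1 / (r : ℚ) + 1 / (r : ℚ) ^ 2) * α else α
  | Sum.inl (Sum.inl q), Sum.inr (Sum.inl S) =>
      if q ∈ S.1 then (1 + 1 / (r : ℚ) + 1 / (r : ℚ) ^ 2) * α else α
  | Sum.inr (Sum.inl S), Sum.inr (Sum.inr Z) => if S ∈ Z.1 then 1 else 0
  | Sum.inr (Sum.inr Z), Sum.inr (Sum.inl S) => if S ∈ Z.1 then 1 else 0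
  | Sum.inl (Sum.inr _), Sum.inr (Sum.inr _) => (ell r : ℚ) / 2 - 1
  | Sum.inr (Sum.inr _), Sum.inl (Sum.inr _) => (ell r : ℚ) / 2 - 1
  | _, _ => 0

/-- The terminal set `Q = Q0 ∪ {x}`. -/
def Qset (r : ℕ) : Finset (Vtx r) :=
  (Finset.univ.image (vq r)) ∪ {vx r}

/-- The total cost of the edges crossing the bipartition `(A, V ∖ A)`. -/
def cutWeight (r : ℕ) (α : ℚ) (A : Finset (Vtx r)) : ℚ :=
  ∑ a ∈ A, ∑ b ∈ Aᶜ, cost r α a b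

/-- `(A, V ∖ A)` is an `S`-separating bipartition: `S ⊆ A` and `Q ∖ S ⊆ V ∖ A`. -/
def SepBip (r : ℕ) (S : Finset (Vtx r)) (A : Finset (Vtx r)) : Prop :=
  S ⊆ A ∧ ∀ t ∈ Qset r \ S, t ∉ A

/-- `(A, V ∖ A)` is a minimum `S`-separating bipartition of `G(r, α)`. -/
def IsMinSepBip (r : ℕ) (α : ℚ) (S : Finset (Vtx r)) (A : Finset (Vtx r)) : Prop :=
  SepBip r S A ∧ ∀ B : Finset (Vtx r), SepBip r S B → cutWeight r α A ≤ cutWeight r α B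

end DoubleExp

namespace DoubleExp

/-- The total cost from `v` to `A` minus the total cost from `v` to the complement of `A`. -/
def pull (r : ℕ) (α : ℚ) (A : Finset (Vtx r)) (v : Vtx r) : ℚ :=
  ∑ b, if b ∈ A then cost r α v b else -cost r α v b

lemma cost_symm (r : ℕ) (α : ℚ) (a b : Vtx r) : cost r α a b = cost r α b a := by
  rcases a with (a | a) | (a | a) <;> rcases b with (b | b) | (b | b) <;> rfl

lemma cost_self (r : ℕ) (α : ℚ) (a : Vtx r) : cost r α a a = 0 := by
  rcases a with (a | a) | (a | a) <;> rfl

lemma pull_eq (r : ℕ) (α : ℚ) (A : Finset (Vtx r)) (v : Vtx r) :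
    pull r α A v = ∑ b ∈ A, cost r α v b - ∑ b ∈ Aᶜ, cost r α v b := by
  rw [pull, ← Finset.sum_add_sum_compl A, sub_eq_add_neg, ← Finset.sum_neg_distrib]
  congr 1
  · exact Finset.sum_congr rfl fun b hb => if_pos hb
  · exact Finset.sum_congr rfl fun b hb => if_neg (Finset.mem_compl.1 hb)

lemma cutWeight_insert (r : ℕ) (α : ℚ) (A : Finset (Vtx r)) (v : Vtx r) (hv : v ∉ A) :
    cutWeight r α (insert v A) = cutWeight r α A - pull r α A v := by
  have hc : (insert v A)ᶜ = Aᶜ.erase v := by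
    ext b; simp
  have hmem : v ∈ Aᶜ := Finset.mem_compl.2 hv
  have herase (a : Vtx r) : ∑ b ∈ Aᶜ.erase v, cost r α a b
      = ∑ b ∈ Aᶜ, cost r α a b - cost r α a v := Finset.sum_erase_eq_sub hmem
  rw [cutWeight, hc, Finset.sum_insert hv, pull_eq, cutWeight]
  simp only [herase, Finset.sum_sub_distrib, cost_self]
  rw [Finset.sum_congr rfl fun a _ => cost_symm r α a v]
  ring

lemma pull_insert (r : ℕ) (α : ℚ) (A : Finset (Vtx r)) (v : Vtx r) :
    pull r α (insert v A) v = pull r α A v := by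
  refine Finset.sum_congr rfl fun b _ => ?_
  by_cases h : b = v
  · subst h; simp [cost_self]
  · simp [h]

lemma IsMinSepBip.pull_nonpos {r : ℕ} {α : ℚ} {S A : Finset (Vtx r)}
    (h : IsMinSepBip r α S A) {v : Vtx r} (hvQ : v ∉ Qset r) (hv : v ∉ A) :
    pull r α A v ≤ 0 := by
  have := h.2 (insert v A) ⟨h.1.1.trans (Finset.subset_insert _ _), fun t ht htA => by
    rcases Finset.mem_insert.1 htA with rfl | htA
    · exact hvQ (Finset.mem_sdiff.1 ht).1
    · exact h.1.2 t ht htA⟩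
  rw [cutWeight_insert r α A v hv] at this
  linarith

lemma IsMinSepBip.pull_nonneg {r : ℕ} {α : ℚ} {S A : Finset (Vtx r)}
    (h : IsMinSepBip r α S A) (hS : S ⊆ Qset r) {v : Vtx r} (hvQ : v ∉ Qset r) (hv : v ∈ A) :
    0 ≤ pull r α A v := by
  have := h.2 (A.erase v) ⟨fun s hs => Finset.mem_erase.2
    ⟨fun e => hvQ (e ▸ hS hs), h.1.1 hs⟩, fun t ht htA => h.1.2 t ht (Finset.mem_of_mem_erase htA)⟩
  have h1 := cutWeight_insert r α (A.erase v) v (Finset.notMem_erase v A)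
  rw [← pull_insert, Finset.insert_erase hv] at h1
  linarith

lemma vu_notMem_Qset (r : ℕ) (S : UIdx r) : vu r S ∉ Qset r := by
  simp [Qset, vu, vq, vx]

lemma vw_notMem_Qset (r : ℕ) (Z : WIdx r) : vw r Z ∉ Qset r := by
  simp [Qset, vw, vq, vx]

/-- The important set `T ∪ {x}`. -/
def importantSet (r : ℕ) (T : UIdx r) : Finset (Vtx r) :=
  insert (vx r) (T.1.image (vq r))

lemma vq_injective (r : ℕ) : Function.Injective (vq r) := fun _ _ h =>
  Sum.inl_injective (Sum.inl_injective h)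

lemma importantSet_subset (r : ℕ) (T : UIdx r) : importantSet r T ⊆ Qset r := by
  intro v hv
  simp only [importantSet, Qset, Finset.mem_insert, Finset.mem_image, Finset.mem_union,
    Finset.mem_singleton, Finset.mem_univ, true_and] at hv ⊢
  rcases hv with rfl | ⟨q, -, rfl⟩
  · exact Or.inr rfl
  · exact Or.inl ⟨q, rfl⟩

lemma card_importantSet (r : ℕ) (T : UIdx r) : (importantSet r T).card = r + 1 := by
  rw [importantSet, Finset.card_insert_of_notMem (by simp [vq, vx]),
    Finset.card_image_of_injective _ (vq_injective r), T.2]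

lemma SepBip.vq_mem_iff {r : ℕ} {T : UIdx r} {A : Finset (Vtx r)}
    (h : SepBip r (importantSet r T) A) (q : Fin (2 * r + 1)) : vq r q ∈ A ↔ q ∈ T.1 := by
  constructor
  · intro hq
    by_contra hqT
    refine h.2 (vq r q) ?_ hq
    simp [Qset, importantSet, vq, vx, hqT]
  · intro hq
    exact h.1 (Finset.mem_insert_of_mem (Finset.mem_image_of_mem _ hq))

lemma sum_vtx (r : ℕ) (f : Vtx r → ℚ) :
    ∑ v, f v = ∑ q, f (vq r q) + f (vx r) + (∑ S, f (vu r S) + ∑ Z, f (vw r Z)) := by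
  simp [Fintype.sum_sum_type, vq, vx, vu, vw]

lemma sum_terminal_pull (r : ℕ) (α d : ℚ) (S T : UIdx r) :
    ∑ q, (if q ∈ T.1 then (if q ∈ S.1 then (1 + d) * α else α)
      else -(if q ∈ S.1 then (1 + d) * α else α))
      = α * (d * (2 * ((S.1 ∩ T.1).card : ℚ) - r) - 1) := by
  have key (q : Fin (2 * r + 1)) : (if q ∈ T.1 then (if q ∈ S.1 then (1 + d) * α else α)
      else -(if q ∈ S.1 then (1 + d) * α else α))
      = 2 * α * (if q ∈ T.1 then 1 else 0) - α + d * α * (2 * (if q ∈ S.1 ∩ T.1 then 1 else 0)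
        - (if q ∈ S.1 then 1 else 0)) := by
    by_cases h1 : q ∈ T.1 <;> by_cases h2 : q ∈ S.1 <;> simp [h1, h2] <;> ring
  simp only [key, Finset.sum_add_distrib, Finset.sum_sub_distrib, ← Finset.mul_sum,
    Finset.sum_boole, Finset.filter_mem_eq_inter, Finset.univ_inter, S.2, T.2, Finset.sum_const,
    Finset.card_univ, Fintype.card_fin, nsmul_eq_mul]
  push_cast
  ring

lemma card_WIdx (r : ℕ) : Fintype.card (WIdx r) = (ell r).choose (ell r / 2) := by
  have hU : Fintype.card (UIdx r) = ell r := by simp [UIdx, ell]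
  rw [Fintype.card_finset_len, hU]

lemma abs_pull_vu_sub_le {r : ℕ} {α : ℚ} {T : UIdx r} {A : Finset (Vtx r)}
    (h : SepBip r (importantSet r T) A) (S : UIdx r) :
    |pull r α A (vu r S) - α * ((1 / (r : ℚ) + 1 / (r : ℚ) ^ 2) *
      (2 * ((S.1 ∩ T.1).card : ℚ) - r) - 1)| ≤ ((ell r).choose (ell r / 2) : ℚ) := by
  rw [pull, sum_vtx, ← sum_terminal_pull]
  simp only [h.vq_mem_iff]
  have hx : cost r α (vu r S) (vx r) = 0 := rfl
  have hu (S' : UIdx r) : cost r α (vu r S) (vu r S') = 0 := rfl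
  have hq (q) : cost r α (vu r S) (vq r q)
    = if q ∈ S.1 then (1 + (1 / (r : ℚ) + 1 / (r : ℚ) ^ 2)) * α else α := by
    rw [← add_assoc]; rfl
  have hw (Z : WIdx r) : cost r α (vu r S) (vw r Z) = if S ∈ Z.1 then 1 else 0 := rfl
  simp only [hx, hu, hq, hw, neg_zero, ite_self, add_zero, Finset.sum_const_zero, zero_add,
    add_sub_cancel_left]
  refine (Finset.abs_sum_le_sum_abs _ _).trans ?_
  rw [← card_WIdx, ← Finset.card_univ, ← nsmul_one]
  refine Finset.sum_le_card_nsmul _ _ _ fun Z _ => ?_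
  split_ifs <;> simp

lemma IsMinSepBip.vu_mem_iff {r : ℕ} (hr : 0 < r) {α : ℚ}
    (hα : (r : ℚ) ^ 2 * (ell r : ℚ) * ((ell r).choose (ell r / 2) : ℚ) < α)
    {T : UIdx r} {A : Finset (Vtx r)} (h : IsMinSepBip r α (importantSet r T) A) (S : UIdx r) :
    vu r S ∈ A ↔ S = T := by
  have hb := abs_le.1 (abs_pull_vu_sub_le (α := α) h.1 S)
  set C : ℚ := ((ell r).choose (ell r / 2) : ℚ)
  have hC : 0 ≤ C := Nat.cast_nonneg _
  have hr1 : (1 : ℚ) ≤ r := by exact_mod_cast hr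
  have hr0 : (0 : ℚ) < r := by linarith
  have hl : (1 : ℚ) ≤ ell r := by
    exact_mod_cast Nat.choose_pos (by omega)
  have hrC : r * C < α / r := by
    rw [lt_div_iff₀ hr0]
    have : (r : ℚ) ^ 2 * C * 1 ≤ (r : ℚ) ^ 2 * C * ell r :=
      mul_le_mul_of_nonneg_left hl (by positivity)
    nlinarith
  have hCα : C < α / r := lt_of_le_of_lt (by nlinarith) hrC
  have hα0 : 0 < α := by
    have := hC.trans_lt hCα
    exact (div_pos_iff_of_pos_right hr0).1 this
  constructor
  · intro hS
    by_contra hne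
    have h0 := h.pull_nonneg (importantSet_subset r T) (vu_notMem_Qset r S) hS
    have hlt : (S.1 ∩ T.1).card + 1 ≤ r := by
      by_contra hcon
      have h1 : S.1 ∩ T.1 = S.1 :=
        Finset.eq_of_subset_of_card_le Finset.inter_subset_left (by rw [S.2]; omega)
      have h2 : S.1 ⊆ T.1 := Finset.inter_eq_left.1 h1
      exact hne (Subtype.ext (Finset.eq_of_subset_of_card_le h2 (by rw [S.2, T.2])))
    have hlt' : ((S.1 ∩ T.1).card : ℚ) + 1 ≤ r := by exact_mod_cast hlt
    have hk : (1 / (r : ℚ) + 1 / (r : ℚ) ^ 2) * (2 * ((S.1 ∩ T.1).card : ℚ) - r) - 1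
        ≤ -(1 / r) := by
      calc _ ≤ (1 / (r : ℚ) + 1 / (r : ℚ) ^ 2) * (r - 2) - 1 := by
            refine sub_le_sub_right (mul_le_mul_of_nonneg_left ?_ (by positivity)) _
            linarith
        _ = -(1 / r) - 2 / r ^ 2 := by field_simp; ring
        _ ≤ _ := by
            have : (0 : ℚ) ≤ 2 / r ^ 2 := by positivity
            linarith
    have := mul_le_mul_of_nonneg_left hk hα0.le
    have e : α * -(1 / r) = -(α / r) := by ring
    linarith
  · rintro rfl
    by_contra hS
    have h0 := h.pull_nonpos (vu_notMem_Qset r S) hS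
    have e : α * ((1 / (r : ℚ) + 1 / (r : ℚ) ^ 2) * (2 * ((S.1 ∩ S.1).card : ℚ) - r) - 1)
        = α / r := by
      rw [Finset.inter_self, S.2]
      field_simp
      ring
    rw [e] at hb
    linarith

lemma pull_vw {r : ℕ} {α : ℚ} {T : UIdx r} {A : Finset (Vtx r)} (hx : vx r ∈ A)
    (hu : ∀ S, vu r S ∈ A ↔ S = T) (Z : WIdx r) :
    pull r α A (vw r Z)
      = (ell r : ℚ) / 2 - 1 - (ell r / 2 : ℕ) + 2 * (if T ∈ Z.1 then 1 else 0) := by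
  have hxw : cost r α (vw r Z) (vx r) = (ell r : ℚ) / 2 - 1 := rfl
  have huw (S : UIdx r) : cost r α (vw r Z) (vu r S) = if S ∈ Z.1 then 1 else 0 := rfl
  have hq (q) : cost r α (vw r Z) (vq r q) = 0 := rfl
  have hw (Z' : WIdx r) : cost r α (vw r Z) (vw r Z') = 0 := rfl
  have key (S : UIdx r) : (if S = T then (if S ∈ Z.1 then (1 : ℚ) else 0)
      else -(if S ∈ Z.1 then 1 else 0))
      = (if S = T then 2 * (if T ∈ Z.1 then 1 else 0) else 0) - (if S ∈ Z.1 then 1 else 0) := by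
    by_cases h1 : S = T
    · subst h1; simp only [if_true]; ring
    · simp [h1]
  rw [pull, sum_vtx]
  simp only [hxw, huw, hq, hw, hu, hx, if_true, neg_zero, ite_self, Finset.sum_const_zero, key,
    Finset.sum_sub_distrib, Finset.sum_ite_eq', Finset.mem_univ, Finset.sum_boole,
    Finset.filter_mem_eq_inter, Finset.univ_inter, Z.2]
  ring

lemma IsMinSepBip.vw_mem_iff {r : ℕ} (hr : 0 < r) {α : ℚ}
    (hα : (r : ℚ) ^ 2 * (ell r : ℚ) * ((ell r).choose (ell r / 2) : ℚ) < α)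
    {T : UIdx r} {A : Finset (Vtx r)} (h : IsMinSepBip r α (importantSet r T) A) (Z : WIdx r) :
    vw r Z ∈ A ↔ T ∈ Z.1 := by
  have hp := pull_vw (α := α) (h.1.1 (Finset.mem_insert_self _ _)) (h.vu_mem_iff hr hα) Z
  have h1 : ((ell r / 2 : ℕ) : ℚ) ≤ (ell r : ℚ) / 2 := Nat.cast_div_le
  have h2 : (ell r : ℚ) ≤ 2 * (ell r / 2 : ℕ) + 1 := by
    exact_mod_cast (by omega : ell r ≤ 2 * (ell r / 2) + 1)
  constructor
  · intro hZ
    by_contra hT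
    have h0 := h.pull_nonneg (importantSet_subset r T) (vw_notMem_Qset r Z) hZ
    rw [hp, if_neg hT] at h0
    linarith
  · intro hT
    by_contra hZ
    have h0 := h.pull_nonpos (vw_notMem_Qset r Z) hZ
    rw [hp, if_pos hT] at h0
    linarith

end DoubleExp

open DoubleExp in
/-- For `α > r²·ℓ·C(ℓ, ℓ/2)` and any two distinct last-layer vertices `w_Z`, `w_{Z'}`
of `G(r, α)`, there is an important set `S ⊆ Q` (i.e. `x ∈ S` and `|S| = r + 1`) such
that every minimum `S`-separating bipartition puts `w_Z` and `w_{Z'}` on opposite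
sides. -/
theorem wZ_wZ'_separated (r : ℕ) (hr : 0 < r) (hmod : r % 4 = 2) (α : ℚ)
    (hα : (r : ℚ) ^ 2 * (ell r : ℚ) * ((ell r).choose (ell r / 2) : ℚ) < α)
    (Z Z' : WIdx r) (hZZ' : Z ≠ Z') :
    ∃ S : Finset (Vtx r), S ⊆ Qset r ∧ vx r ∈ S ∧ S.card = r + 1 ∧
      ∀ A : Finset (Vtx r), IsMinSepBip r α S A → (vw r Z ∈ A ↔ vw r Z' ∉ A) := by
  obtain ⟨T, hT⟩ : ∃ T, ¬(T ∈ Z.1 ↔ T ∈ Z'.1) := by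
    by_contra! hall
    exact hZZ' (Subtype.ext (Finset.ext hall))
  refine ⟨importantSet r T, importantSet_subset r T, Finset.mem_insert_self _ _,
    card_importantSet r T, fun A hA => ?_⟩
  rw [hA.vw_mem_iff hr hα, hA.vw_mem_iff hr hα]
  tauto
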